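/- The set B_hypo consisting of the three identities (L) xyzxty ≈ yxzxty, (M) xzxytx ≈ xzyxtx, and (R) xzytxy ≈ xzytyx (over distinct variables x, y, z, t) is a finite equational basis for the variety generated by the hypoplactic monoid hypo. Semantically: for every identity u ≈ v over any alphabet of variables, hypo satisfies u ≈ v if and only if every monoid that satisfies all three identities (L), (M), (R) also satisfies u ≈ v. -/

import Mathlib

open FreeMonoid

/-- The alphabet `A = {1 < 2 < 3 < ...}` of positive integers. -/
abbrev Alph : Type := ℕ+

/-- The finite alphabet `A_n = {1 < ... < n}`. -/
abbrev AlphN (n : ℕ) : Type := {a : ℕ+ // (a : ℕ) ≤ n}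

/-- The defining relations of the hypoplactic monoid. -/
def HypoRel (u v : FreeMonoid Alph) : Prop :=
  (∃ a b c : Alph, a ≤ b ∧ b < c ∧
      u = of a * of c * of b ∧ v = of c * of a * of b) ∨
  (∃ a b c : Alph, a < b ∧ b ≤ c ∧
      u = of b * of a * of c ∧ v = of b * of c * of a) ∨
  (∃ a b c d : Alph, a ≤ b ∧ b < c ∧ c ≤ d ∧
      u = of c * of a * of d * of b ∧ v = of a * of c * of b * of d) ∨
  (∃ a b c d : Alph, a < b ∧ b ≤ c ∧ c < d ∧
      u = of b * of d * of a * of c ∧ v = of d * of b * of c * of a)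

/-- The hypoplactic congruence on `A*`: the congruence generated by `HypoRel`. -/
def hypoCon : Con (FreeMonoid Alph) := conGen HypoRel

/-- The infinite-rank hypoplactic monoid `hypo`. -/
abbrev Hypo : Type := hypoCon.Quotient

/-- The inclusion of `A_n*` into `A*`. -/
def inclN (n : ℕ) : FreeMonoid (AlphN n) →* FreeMonoid Alph :=
  FreeMonoid.map Subtype.val

/-- The hypoplactic congruence restricted to `A_n*`. -/
def hypoConN (n : ℕ) : Con (FreeMonoid (AlphN n)) :=
  hypoCon.comap (inclN n) (fun x y => map_mul (inclN n) x y)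

/-- The rank-`n` hypoplactic monoid `hypo_n`. -/
abbrev HypoN (n : ℕ) : Type := (hypoConN n).Quotient

/-- The letter `1` of `A_2`. -/
def a1 : AlphN 2 := ⟨1, by norm_num⟩

/-- The letter `2` of `A_2`. -/
def a2 : AlphN 2 := ⟨2, by norm_num⟩

/-- The homomorphism `φ_{ij} : A* → hypo_2`, sending `i ↦ [1]`, `j ↦ [2]`,
`a ↦ [21]` for `i < a < j`, and every other letter to the identity. -/
def phi (i j : Alph) : FreeMonoid Alph →* HypoN 2 :=
  FreeMonoid.lift fun a =>
    if a = i then (hypoConN 2).mk' (of a1)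
    else if a = j then (hypoConN 2).mk' (of a2)
    else if i < a ∧ a < j then (hypoConN 2).mk' (of a2 * of a1)
    else 1

/-- A monoid `M` satisfies the identity `u ≈ v` (over the alphabet of variables `X`)
if every homomorphic evaluation of the two words in `M` gives equal values. -/
def MSatisfies (M : Type*) [Monoid M] {X : Type*} (u v : FreeMonoid X) : Prop :=
  ∀ ψ : FreeMonoid X →* M, ψ u = ψ v

/-- An identity `u ≈ v` is balanced if every variable occurs the same number of
times in `u` as in `v`. -/
def IsBalanced {X : Type*} [DecidableEq X] (u v : FreeMonoid X) : Prop :=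
  ∀ x : X, u.toList.count x = v.toList.count x

/-- The left side of identity (L): `xyzxty` (variables `x = 0`, `y = 1`, `z = 2`, `t = 3`). -/
def wL1 : FreeMonoid (Fin 4) := of 0 * of 1 * of 2 * of 0 * of 3 * of 1
/-- The right side of identity (L): `yxzxty`. -/
def wL2 : FreeMonoid (Fin 4) := of 1 * of 0 * of 2 * of 0 * of 3 * of 1
/-- The left side of identity (M): `xzxytx`. -/
def wM1 : FreeMonoid (Fin 4) := of 0 * of 2 * of 0 * of 1 * of 3 * of 0
/-- The right side of identity (M): `xzyxtx`. -/
def wM2 : FreeMonoid (Fin 4) := of 0 * of 2 * of 1 * of 0 * of 3 * of 0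
/-- The left side of identity (R): `xzytxy`. -/
def wR1 : FreeMonoid (Fin 4) := of 0 * of 2 * of 1 * of 3 * of 0 * of 1
/-- The right side of identity (R): `xzytyx`. -/
def wR2 : FreeMonoid (Fin 4) := of 0 * of 2 * of 1 * of 3 * of 1 * of 0

section WordVal

variable {α H : Type*} [Monoid H]

/-- The value of a word under a map on letters. -/
def wordVal (g : α → H) (s : List α) : H := (s.map g).prod

@[simp] theorem wordVal_nil (g : α → H) : wordVal g [] = 1 := rfl

@[simp] theorem wordVal_cons (g : α → H) (a : α) (s : List α) :
    wordVal g (a :: s) = g a * wordVal g s := by simp [wordVal]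

@[simp] theorem wordVal_append (g : α → H) (s t : List α) :
    wordVal g (s ++ t) = wordVal g s * wordVal g t := by simp [wordVal]

end WordVal

section LetterSwaps

variable {α H : Type*} [LinearOrder α] [Monoid H]

/-- A family of elements of a monoid obeying the hypoplactic relations. -/
structure IsHypoFamily (g : α → H) : Prop where
  left : ∀ {a b c}, a ≤ b → b < c → g a * g c * g b = g c * g a * g b
  right : ∀ {a b c}, a < b → b ≤ c → g b * g a * g c = g b * g c * g a
  inner : ∀ {a b c d}, a ≤ b → b < c → c ≤ d →
    g c * g a * g d * g b = g a * g c * g b * g d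
  outer : ∀ {a b c d}, a < b → b ≤ c → c < d →
    g b * g d * g a * g c = g d * g b * g c * g a

/-- Two adjacent letters commute before a letter `b` between them at distance at most `n`. -/
def SwapBefore (g : α → H) (n : ℕ) : Prop :=
  ∀ (a b c : α) (s : List α) (t : H), a ≤ b → b < c → s.length ≤ n →
    g a * (g c * (wordVal g s * (g b * t))) = g c * (g a * (wordVal g s * (g b * t)))

/-- Two adjacent letters commute after a letter `b` between them at distance at most `n`. -/
def SwapAfter (g : α → H) (n : ℕ) : Prop :=
  ∀ (a b c : α) (s : List α) (t : H), a < b → b ≤ c → s.length ≤ n →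
    g b * (wordVal g s * (g a * (g c * t))) = g b * (wordVal g s * (g c * (g a * t)))

theorem List.forall_or_exists_first {β : Type*} {P Q : β → Prop} (s : List β)
    (h : ∀ x ∈ s, P x ∨ Q x) :
    (∀ x ∈ s, Q x) ∨ ∃ s₁ y s₂, s = s₁ ++ y :: s₂ ∧ P y ∧ ∀ x ∈ s₁, Q x := by
  induction s with
  | nil => simp
  | cons z s ih =>
    rcases h z (by simp) with hz | hz
    · exact Or.inr ⟨[], z, s, by simp, hz, by simp⟩
    · rcases ih fun x hx => h x (by simp [hx]) with hs | ⟨s₁, y, s₂, rfl, hy, hs⟩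
      · exact Or.inl (by simpa [hz] using hs)
      · exact Or.inr ⟨z :: s₁, y, s₂, by simp, hy, by simpa [hz] using hs⟩

variable {g : α → H} {n : ℕ}

theorem SwapAfter.move_large (hR : SwapAfter g n) {b h : α} (hbh : b ≤ h) (s : List α)
    (hs : ∀ f ∈ s, f < b) (hn : s.length ≤ n + 1) (t : H) :
    g b * (wordVal g s * (g h * t)) = g b * (g h * (wordVal g s * t)) := by
  induction s using List.reverseRecOn generalizing t with
  | nil => simp
  | append_singleton s f ih =>
    have h1 := hR f b h s t (hs f (by simp)) hbh (by simpa using hn)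
    have h2 := ih (fun x hx => hs x (by simp [hx])) (by simp at hn; omega) (g f * t)
    simp [mul_assoc, h1, h2]

theorem SwapAfter.move_small (hR : SwapAfter g n) {b f : α} (hfb : f < b) (s : List α)
    (hs : ∀ h ∈ s, b ≤ h) (hn : s.length ≤ n + 1) (t : H) :
    g b * (wordVal g s * (g f * t)) = g b * (g f * (wordVal g s * t)) := by
  induction s using List.reverseRecOn generalizing t with
  | nil => simp
  | append_singleton s h ih =>
    have h1 := hR f b h s t hfb (hs h (by simp)) (by simpa using hn)
    have h2 := ih (fun x hx => hs x (by simp [hx])) (by simp at hn; omega) (g h * t)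
    simp [mul_assoc, ← h1, h2]

theorem IsHypoFamily.inner_far (hg : IsHypoFamily g) (hL : SwapBefore g n) (hR : SwapAfter g n)
    {a b c e : α} (hea : e ≤ a) (hab : a < b) (hbc : b ≤ c) (s : List α) (hn : s.length ≤ n)
    (t : H) :
    g b * (g e * (wordVal g s * (g c * (g a * t)))) =
      g e * (g b * (wordVal g s * (g a * (g c * t)))) := by
  induction hk : s.length using Nat.strong_induction_on generalizing s t with
  | _ k ih =>
  by_cases hmid : ∃ x ∈ s, e ≤ x ∧ x ≤ c
  · obtain ⟨x, hx, hex, hxc⟩ := hmid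
    obtain ⟨s₁, s₂, rfl⟩ := List.append_of_mem hx
    simp only [List.length_append, List.length_cons] at hn
    rcases lt_or_ge a x with hax | hxa
    · have h1 := hR a x c s₂ t hax hxc (by omega)
      have h2 := hL e a b (s₁ ++ x :: s₂) (g c * t) hea hab (by simp; omega)
      simp only [wordVal_append, wordVal_cons, mul_assoc] at h2 ⊢
      rw [← h1, h2]
    · have h1 := hL e x b s₁ (wordVal g s₂ * (g c * (g a * t))) hex (hxa.trans_lt hab) (by omega)
      have h2 := hR a b c (s₁ ++ x :: s₂) t hab hbc (by simp; omega)
      simp only [wordVal_append, wordVal_cons, mul_assoc] at h2 ⊢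
      rw [← h1, h2]
  · rcases List.forall_or_exists_first (P := fun x => c < x) (Q := fun x => x < e) s
      (fun x hx => by
        by_contra hcon
        simp only [not_or, not_lt] at hcon
        exact hmid ⟨x, hx, hcon.2, hcon.1⟩) with hs | ⟨s₁, h, s₂, rfl, hh, hs⟩
    · rcases List.eq_nil_or_concat s with rfl | ⟨s', f, rfl⟩
      · have := congrArg (· * t) (hg.inner hea hab hbc)
        simpa [mul_assoc] using this
      · simp only [List.concat_eq_append, List.length_append, List.length_singleton] at *
        have hf : f < e := hs f (by simp)
        have h1 := hR f e c s' (g a * t) hf (hea.trans (hab.le.trans hbc)) (by omega)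
        have h2 := hR f e a (s' ++ [c]) t hf hea (by simp; omega)
        have h3 := ih s'.length (by omega) s' (by omega) (g f * t) rfl
        have h4 := hR f b c (s' ++ [a]) t (hf.trans_le (hea.trans hab.le)) hbc (by simp; omega)
        have h5 := hR f e a (b :: s') (g c * t) hf hea (by simp; omega)
        simp only [wordVal_append, wordVal_cons, wordVal_nil, mul_assoc, one_mul]
          at h1 h2 h3 h4 h5 ⊢
        rw [h1, h2, h3, ← h4, ← h5]
    · simp only [List.length_append, List.length_cons] at hn hk
      have heb : e < b := hea.trans_lt hab
      have hbh : b < h := hbc.trans_lt hh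
      have hm1 := hR.move_large hbh.le (e :: s₁)
        (by simpa [heb] using fun x hx => (hs x hx).trans heb) (by simp; omega)
        (wordVal g s₂ * (g c * (g a * t)))
      have h1 := hL b c h (e :: s₁ ++ s₂) (g a * t) hbc hh (by simp; omega)
      have h2 := ih (s₁ ++ s₂).length (by simp; omega) (s₁ ++ s₂) (by simp; omega) t rfl
      have h3 := hL e b h [] (wordVal g s₁ * (wordVal g s₂ * (g a * (g c * t)))) heb.le hbh
        (by simp)
      have h4 := hL b c h (s₁ ++ s₂ ++ [a]) t hbc hh (by simp; omega)
      have hm2 := hR.move_large hbh.le s₁ (fun x hx => (hs x hx).trans heb) (by omega)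
        (wordVal g s₂ * (g a * (g c * t)))
      simp only [wordVal_append, wordVal_cons, wordVal_nil, mul_assoc, one_mul]
        at hm1 hm2 h1 h2 h3 h4 ⊢
      rw [hm1, h1, h2, ← h3, ← h4, ← hm2]

theorem IsHypoFamily.outer_far (hg : IsHypoFamily g) (hL : SwapBefore g n) (hR : SwapAfter g n)
    {a b c e : α} (hab : a < b) (hbc : b ≤ c) (hce : c < e) (s : List α) (hn : s.length ≤ n)
    (t : H) :
    g b * (g e * (wordVal g s * (g a * (g c * t)))) =
      g e * (g b * (wordVal g s * (g c * (g a * t)))) := by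
  induction hk : s.length using Nat.strong_induction_on generalizing s t with
  | _ k ih =>
  have hbe : b < e := hbc.trans_lt hce
  by_cases hmid : ∃ x ∈ s, a < x ∧ x < e
  · obtain ⟨x, hx, hax, hxe⟩ := hmid
    obtain ⟨s₁, s₂, rfl⟩ := List.append_of_mem hx
    simp only [List.length_append, List.length_cons] at hn
    rcases lt_or_ge c x with hcx | hxc
    · have h1 := hL b x e s₁ (wordVal g s₂ * (g a * (g c * t))) (hbc.trans hcx.le) hxe (by omega)
      have h2 := hR a b c (s₁ ++ x :: s₂) t hab hbc (by simp; omega)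
      simp only [wordVal_append, wordVal_cons, mul_assoc] at h2 ⊢
      rw [h1, h2]
    · have h1 := hR a x c s₂ t hax hxc (by omega)
      have h2 := hL b c e (s₁ ++ x :: s₂) (g a * t) hbc hce (by simp; omega)
      simp only [wordVal_append, wordVal_cons, mul_assoc] at h2 ⊢
      rw [h1, h2]
  · rcases List.forall_or_exists_first (P := fun x => x ≤ a) (Q := fun x => e ≤ x) s
      (fun x hx => by
        by_contra hcon
        simp only [not_or, not_le] at hcon
        exact hmid ⟨x, hx, hcon.1, hcon.2⟩) with hs | ⟨s₁, f, s₂, rfl, hf, hs⟩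
    · rcases List.eq_nil_or_concat s with rfl | ⟨s', h, rfl⟩
      · have := congrArg (· * t) (hg.outer hab hbc hce)
        simpa [mul_assoc] using this
      · simp only [List.concat_eq_append, List.length_append, List.length_singleton] at *
        have hh : e ≤ h := hs h (by simp)
        have h1 := hR a e h s' (g c * t) (hab.trans hbe) hh (by omega)
        have h2 := hR c e h (s' ++ [a]) t hce hh (by simp; omega)
        have h3 := ih s'.length (by omega) s' (by omega) (g h * t) rfl
        have h4 := hR a b h (s' ++ [c]) t hab (hbe.le.trans hh) (by simp; omega)
        have h5 := hR c e h (b :: s') (g a * t) hce hh (by simp; omega)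
        simp only [wordVal_append, wordVal_cons, wordVal_nil, mul_assoc, one_mul]
          at h1 h2 h3 h4 h5 ⊢
        rw [← h1, ← h2, h3, h4, h5]
    · simp only [List.length_append, List.length_cons] at hn hk
      have hfb : f < b := hf.trans_lt hab
      have hm1 := hR.move_small hfb (e :: s₁)
        (by simpa [hbe.le] using fun x hx => hbe.le.trans (hs x hx)) (by simp; omega)
        (wordVal g s₂ * (g a * (g c * t)))
      have h1 := hL f a b (e :: s₁ ++ s₂) (g c * t) hf hab (by simp; omega)
      have h2 := ih (s₁ ++ s₂).length (by simp; omega) (s₁ ++ s₂) (by simp; omega) t rfl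
      have h3 := hL f b e [] (wordVal g s₁ * (wordVal g s₂ * (g c * (g a * t)))) hfb.le hbe
        (by simp)
      have h4 := hL f a b (s₁ ++ s₂ ++ [c]) t hf hab (by simp; omega)
      have hm2 := hR.move_small hfb s₁ (fun x hx => hbe.le.trans (hs x hx)) (by omega)
        (wordVal g s₂ * (g c * (g a * t)))
      simp only [wordVal_append, wordVal_cons, wordVal_nil, mul_assoc, one_mul]
        at hm1 hm2 h1 h2 h3 h4 ⊢
      rw [hm1, ← h1, h2, h3, h4, ← hm2]

theorem IsHypoFamily.swap_far (hg : IsHypoFamily g) (n : ℕ) :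
    SwapBefore g n ∧ SwapAfter g n := by
  induction n with
  | zero =>
    constructor
    · intro a b c s t hab hbc hs
      obtain rfl : s = [] := by simpa using hs
      have := congrArg (· * t) (hg.left hab hbc)
      simpa [mul_assoc] using this
    · intro a b c s t hab hbc hs
      obtain rfl : s = [] := by simpa using hs
      have := congrArg (· * t) (hg.right hab hbc)
      simpa [mul_assoc] using this
  | succ n ih =>
    obtain ⟨hL, hR⟩ := ih
    constructor
    · intro a b c s t hab hbc hs
      rcases List.eq_nil_or_concat s with rfl | ⟨s, d, rfl⟩
      · exact hL a b c [] t hab hbc (by simp)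
      simp only [List.concat_eq_append, List.length_append, List.length_singleton,
        add_le_add_iff_right] at hs
      simp only [List.concat_eq_append, wordVal_append, wordVal_cons, wordVal_nil, mul_assoc,
        one_mul]
      rcases lt_or_ge d a with hda | had
      · rw [hg.outer_far hL hR hda hab hbc s hs, ← hR d a b s t hda hab hs]
      · rcases lt_or_ge d c with hdc | hcd
        · exact hL a d c s _ had hdc hs
        · rw [hg.inner_far hL hR hab hbc hcd s hs, ← hR b c d s t hbc hcd hs]
    · intro a b c s t hab hbc hs
      cases s with
      | nil => exact hR a b c [] t hab hbc (by simp)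
      | cons e s =>
      simp only [List.length_cons, add_le_add_iff_right] at hs
      simp only [wordVal_cons, mul_assoc]
      rcases lt_or_ge a e with hae | hea
      · rcases lt_or_ge c e with hce | hec
        · rw [hg.outer_far hL hR hab hbc hce s hs, hL b c e s _ hbc hce hs]
        · rw [hR a e c s t hae hec hs]
      · rw [hg.inner_far hL hR hea hab hbc s hs, hL e a b s _ hea hab hs]

/-- A sufficient condition for adjacent letters `a`, `c` to commute between `p` and `s`. -/
def SwapContext {β : Type*} (p s : List β) (a c : β) : Prop :=
  (a ∈ p ∨ c ∈ s) ∧ (c ∈ p ∨ a ∈ s)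

theorem SwapContext.mono {β : Type*} {p s p' s' : List β} {a c : β} (h : SwapContext p s a c)
    (hp : p ⊆ p') (hs : s ⊆ s') : SwapContext p' s' a c :=
  ⟨h.1.imp (@hp _) (@hs _), h.2.imp (@hp _) (@hs _)⟩

theorem IsHypoFamily.swap_of_mem_right (hg : IsHypoFamily g) {a c : α} (hac : a < c)
    {s : List α} (h : a ∈ s) :
    g a * (g c * wordVal g s) = g c * (g a * wordVal g s) := by
  obtain ⟨s₁, s₂, rfl⟩ := List.append_of_mem h
  simpa using (hg.swap_far s₁.length).1 a a c s₁ (wordVal g s₂) le_rfl hac le_rfl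

theorem IsHypoFamily.swap_of_mem_left (hg : IsHypoFamily g) {a c : α} (hac : a < c)
    {p : List α} (h : c ∈ p) (t : H) :
    wordVal g p * (g a * (g c * t)) = wordVal g p * (g c * (g a * t)) := by
  obtain ⟨p₁, p₂, rfl⟩ := List.append_of_mem h
  simpa [mul_assoc] using congrArg (wordVal g p₁ * ·)
    ((hg.swap_far p₂.length).2 a c c p₂ t hac le_rfl le_rfl)

theorem IsHypoFamily.swap_letters (hg : IsHypoFamily g) {a c : α} {p s : List α}
    (h : SwapContext p s a c) :
    wordVal g p * (g a * (g c * wordVal g s)) = wordVal g p * (g c * (g a * wordVal g s)) := by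
  rcases lt_trichotomy a c with hac | rfl | hca
  · rcases h.2 with hc | ha
    · exact hg.swap_of_mem_left hac hc _
    · rw [hg.swap_of_mem_right hac ha]
  · rfl
  · rcases h.1 with ha | hc
    · exact (hg.swap_of_mem_left hca ha _).symm
    · rw [hg.swap_of_mem_right hca hc]

theorem IsHypoFamily.swap_letter_word (hg : IsHypoFamily g) {a : α} (y p s : List α)
    (h : ∀ c ∈ y, SwapContext p s a c) :
    wordVal g p * (g a * (wordVal g y * wordVal g s)) =
      wordVal g p * (wordVal g y * (g a * wordVal g s)) := by
  induction y generalizing p with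
  | nil => simp
  | cons c y ih =>
    have h1 := hg.swap_letters (s := y ++ s)
      ((h c (by simp)).mono (List.Subset.refl p) (List.subset_append_right y s))
    have h2 := ih (p ++ [c]) fun d hd =>
      (h d (by simp [hd])).mono (List.subset_append_left p [c]) (List.Subset.refl s)
    simp only [wordVal_append, wordVal_cons, wordVal_nil, mul_assoc, one_mul] at h1 h2 ⊢
    rw [h1, h2]

theorem IsHypoFamily.swap_words (hg : IsHypoFamily g) (x y p s : List α)
    (h : ∀ a ∈ x, ∀ c ∈ y, SwapContext p s a c) :
    wordVal g p * (wordVal g x * (wordVal g y * wordVal g s)) =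
      wordVal g p * (wordVal g y * (wordVal g x * wordVal g s)) := by
  induction x generalizing p with
  | nil => simp
  | cons a x ih =>
    have h1 := ih (p ++ [a]) fun b hb c hc =>
      (h b (by simp [hb]) c hc).mono (List.subset_append_left p [a]) (List.Subset.refl s)
    have h2 := hg.swap_letter_word y p (x ++ s) fun c hc =>
      (h a (by simp) c hc).mono (List.Subset.refl p) (List.subset_append_right x s)
    simp only [wordVal_append, wordVal_cons, wordVal_nil, mul_assoc, one_mul] at h1 h2 ⊢
    rw [h1, h2]

end LetterSwaps

section HypoIdentities

/-- The generator of `Hypo` given by a letter. -/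
def hypoLetter (a : Alph) : Hypo := hypoCon.mk' (of a)

theorem isHypoFamily_hypoLetter : IsHypoFamily hypoLetter := by
  have key : ∀ {u v}, HypoRel u v → hypoCon.mk' u = hypoCon.mk' v := fun h =>
    hypoCon.eq.2 (ConGen.Rel.of _ _ h)
  constructor
  · intro a b c h1 h2
    simpa [hypoLetter] using key (Or.inl ⟨a, b, c, h1, h2, rfl, rfl⟩)
  · intro a b c h1 h2
    simpa [hypoLetter] using key (Or.inr (Or.inl ⟨a, b, c, h1, h2, rfl, rfl⟩))
  · intro a b c d h1 h2 h3
    simpa [hypoLetter] using key (Or.inr (Or.inr (Or.inl ⟨a, b, c, d, h1, h2, h3, rfl, rfl⟩)))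
  · intro a b c d h1 h2 h3
    simpa [hypoLetter] using key (Or.inr (Or.inr (Or.inr ⟨a, b, c, d, h1, h2, h3, rfl, rfl⟩)))

theorem exists_wordVal_hypoLetter (m : Hypo) : ∃ s, m = wordVal hypoLetter s := by
  obtain ⟨w, rfl⟩ := Con.mk'_surjective m
  refine ⟨w.toList, ?_⟩
  induction w using FreeMonoid.inductionOn' with
  | one => simp
  | of_mul a w ih => rw [map_mul, ih, FreeMonoid.toList_of_mul, wordVal_cons, hypoLetter]

theorem hypo_satisfies_basis :
    MSatisfies Hypo wL1 wL2 ∧ MSatisfies Hypo wM1 wM2 ∧ MSatisfies Hypo wR1 wR2 := by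
  have hg := isHypoFamily_hypoLetter
  refine ⟨fun ψ => ?_, fun ψ => ?_, fun ψ => ?_⟩ <;>
  obtain ⟨x, hx⟩ := exists_wordVal_hypoLetter (ψ (of 0)) <;>
  obtain ⟨y, hy⟩ := exists_wordVal_hypoLetter (ψ (of 1)) <;>
  obtain ⟨z, hz⟩ := exists_wordVal_hypoLetter (ψ (of 2)) <;>
  obtain ⟨t, ht⟩ := exists_wordVal_hypoLetter (ψ (of 3))
  · have := hg.swap_words x y [] (z ++ x ++ t ++ y)
      fun a ha c hc => ⟨Or.inr (by simp [hc]), Or.inr (by simp [ha])⟩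
    simpa [wL1, wL2, hx, hy, hz, ht, mul_assoc] using this
  · have := hg.swap_words x y (x ++ z) (t ++ x)
      fun a ha c hc => ⟨Or.inl (by simp [ha]), Or.inr (by simp [ha])⟩
    simpa [wM1, wM2, hx, hy, hz, ht, mul_assoc] using this
  · have := hg.swap_words x y (x ++ z ++ y ++ t) []
      fun a ha c hc => ⟨Or.inl (by simp [ha]), Or.inl (by simp [hc])⟩
    simpa [wR1, wR2, hx, hy, hz, ht, mul_assoc] using this

end HypoIdentities

section Invariants

theorem List.pair_sublist_append {β : Type*} {s t : β} {l₁ l₂ : List β} :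
    [s, t].Sublist (l₁ ++ l₂) ↔
      [s, t].Sublist l₁ ∨ [s, t].Sublist l₂ ∨ (s ∈ l₁ ∧ t ∈ l₂) := by
  induction l₁ with
  | nil => simp
  | cons a l ih =>
    simp only [List.cons_append, List.sublist_cons_iff, List.cons.injEq] at ih ⊢
    simp only [ih]
    simp
    grind

theorem List.pair_sublist_cons {β : Type*} {s t a : β} {l : List β} :
    [s, t].Sublist (a :: l) ↔ (s = a ∧ t ∈ l) ∨ [s, t].Sublist l := by
  simp only [List.sublist_cons_iff, List.cons.injEq]
  simp
  grind

/-- Words with the same number of occurrences of `1` and of `2` which agree on whether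
some `2` precedes some `1`. -/
def inversionCon : Con (FreeMonoid Alph) where
  r u v := u.toList.count 1 = v.toList.count 1 ∧ u.toList.count 2 = v.toList.count 2 ∧
    ([2, 1].Sublist u.toList ↔ [2, 1].Sublist v.toList)
  iseqv := ⟨fun _ => ⟨rfl, rfl, Iff.rfl⟩, fun h => ⟨h.1.symm, h.2.1.symm, h.2.2.symm⟩,
    fun h k => ⟨h.1.trans k.1, h.2.1.trans k.2.1, h.2.2.trans k.2.2⟩⟩
  mul' := by
    rintro u v w z ⟨h1, h2, h3⟩ ⟨k1, k2, k3⟩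
    simp only [FreeMonoid.toList_mul, List.count_append, List.pair_sublist_append]
    refine ⟨by rw [h1, k1], by rw [h2, k2], ?_⟩
    rw [h3, k3, ← List.count_pos_iff, ← List.count_pos_iff, ← List.count_pos_iff (l := v.toList),
      ← List.count_pos_iff (l := z.toList), h2, k1]

theorem hypoCon_le_inversionCon : hypoCon ≤ inversionCon := by
  refine Con.conGen_le.2 ?_
  intro u v h
  rcases h with ⟨a, b, c, h1, h2, rfl, rfl⟩ | ⟨a, b, c, h1, h2, rfl, rfl⟩ |
    ⟨a, b, c, d, h1, h2, h3, rfl, rfl⟩ | ⟨a, b, c, d, h1, h2, h3, rfl, rfl⟩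
  all_goals
    refine ⟨?_, ?_, ?_⟩
    · simp [List.count_cons]; try omega
    · simp [List.count_cons]; try omega
    · have ha := a.pos
      have hb := b.pos
      have hc := c.pos
      simp only [← PNat.coe_le_coe, ← PNat.coe_lt_coe] at h1 h2
      try simp only [← PNat.coe_le_coe, ← PNat.coe_lt_coe] at h3
      simp [List.pair_sublist_cons, ← PNat.coe_inj]
      omega

variable {X : Type*}

open Classical in
/-- The substitution `x ↦ 1`, `y ↦ 2`, erasing the other variables. -/
noncomputable def pairSubst (x y : X) : FreeMonoid X →* FreeMonoid Alph :=
  FreeMonoid.lift fun z => if z = x then of 1 else if z = y then of 2 else 1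

open Classical in
theorem count_one_pairSubst (x y : X) (u : FreeMonoid X) :
    (pairSubst x y u).toList.count 1 = u.toList.count x := by
  induction u using FreeMonoid.inductionOn' with
  | one => simp
  | of_mul z u ih =>
    simp only [map_mul, FreeMonoid.toList_mul, List.count_append, ih]
    simp only [pairSubst, FreeMonoid.lift_eval_of]
    split_ifs <;> simp [List.count_cons] <;> grind

theorem inversion_pairSubst {x y : X} (hxy : x ≠ y) (u : FreeMonoid X) :
    [2, 1].Sublist (pairSubst x y u).toList ↔ [y, x].Sublist u.toList := by
  classical
  induction u using FreeMonoid.inductionOn' with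
  | one => simp
  | of_mul z u ih =>
    have h1 : 1 ∈ (pairSubst x y u).toList ↔ x ∈ u.toList := by
      rw [← List.count_pos_iff, ← List.count_pos_iff, count_one_pairSubst]
    simp only [map_mul, FreeMonoid.toList_mul, List.pair_sublist_append, ih, h1]
    simp only [pairSubst, FreeMonoid.lift_eval_of]
    split_ifs with h1 h2 <;> simp <;> grind

theorem MSatisfies.inversionCon_pairSubst {u v : FreeMonoid X} (h : MSatisfies Hypo u v)
    (x y : X) : inversionCon (pairSubst x y u) (pairSubst x y v) :=
  hypoCon_le_inversionCon (hypoCon.eq.1 (h (hypoCon.mk'.comp (pairSubst x y))))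

theorem MSatisfies.perm_of_hypo {u v : FreeMonoid X} (h : MSatisfies Hypo u v) :
    u.toList.Perm v.toList := by
  classical
  refine List.perm_iff_count.2 fun x => ?_
  simpa only [count_one_pairSubst] using (h.inversionCon_pairSubst x x).1

theorem MSatisfies.pair_sublist_of_hypo {u v : FreeMonoid X} (h : MSatisfies Hypo u v) {x y : X}
    (hxy : x ≠ y) : [x, y].Sublist u.toList ↔ [x, y].Sublist v.toList := by
  simpa only [inversion_pairSubst hxy.symm] using (h.inversionCon_pairSubst y x).2.2

end Invariants

section Completeness

variable {X M : Type*} [Monoid M]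

theorem basis_identities (hL : MSatisfies M wL1 wL2) (hM : MSatisfies M wM1 wM2)
    (hR : MSatisfies M wR1 wR2) (x y z t : M) :
    x * y * z * x * t * y = y * x * z * x * t * y ∧
    x * z * x * y * t * x = x * z * y * x * t * x ∧
    x * z * y * t * x * y = x * z * y * t * y * x := by
  have h1 := hL (FreeMonoid.lift ![x, y, z, t])
  have h2 := hM (FreeMonoid.lift ![x, y, z, t])
  have h3 := hR (FreeMonoid.lift ![x, y, z, t])
  exact ⟨by simpa [wL1, wL2] using h1, by simpa [wM1, wM2] using h2,
    by simpa [wR1, wR2] using h3⟩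

theorem List.mem_and_mem_split {β : Type*} {x y : β} (hxy : x ≠ y) {s : List β} (hx : x ∈ s)
    (hy : y ∈ s) : (∃ p q r, s = p ++ x :: q ++ y :: r) ∨ ∃ p q r, s = p ++ y :: q ++ x :: r := by
  obtain ⟨p, q, rfl⟩ := List.append_of_mem hx
  have : y ∈ p ∨ y ∈ q := by simpa [hxy.symm] using hy
  rcases this with h | h <;> obtain ⟨r, s, rfl⟩ := List.append_of_mem h
  · exact Or.inr ⟨r, s, q, by simp⟩
  · exact Or.inl ⟨p, r, s, by simp⟩

theorem swap_of_basis (hL : MSatisfies M wL1 wL2) (hM : MSatisfies M wM1 wM2)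
    (hR : MSatisfies M wR1 wR2) (g : X → M) {p s : List X} {x y : X}
    (h : SwapContext p s x y) :
    wordVal g (p ++ x :: y :: s) = wordVal g (p ++ y :: x :: s) := by
  have key := basis_identities hL hM hR
  simp only [mul_assoc] at key
  rcases eq_or_ne x y with rfl | hxy
  · rfl
  obtain ⟨h1, h2⟩ := h
  rcases h1 with hxp | hys <;> rcases h2 with hyp | hxs
  · rcases List.mem_and_mem_split hxy hxp hyp with ⟨a, b, c, rfl⟩ | ⟨a, b, c, rfl⟩
    · have := congrArg (wordVal g a * · * wordVal g s)
        (key (g x) (g y) (wordVal g b) (wordVal g c)).2.2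
      simpa [mul_assoc] using this
    · have := congrArg (wordVal g a * · * wordVal g s)
        (key (g y) (g x) (wordVal g b) (wordVal g c)).2.2
      simpa [mul_assoc] using this.symm
  · obtain ⟨a, b, rfl⟩ := List.append_of_mem hxp
    obtain ⟨c, d, rfl⟩ := List.append_of_mem hxs
    have := congrArg (wordVal g a * · * wordVal g d)
      (key (g x) (g y) (wordVal g b) (wordVal g c)).2.1
    simpa [mul_assoc] using this
  · obtain ⟨a, b, rfl⟩ := List.append_of_mem hyp
    obtain ⟨c, d, rfl⟩ := List.append_of_mem hys
    have := congrArg (wordVal g a * · * wordVal g d)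
      (key (g y) (g x) (wordVal g b) (wordVal g c)).2.1
    simpa [mul_assoc] using this.symm
  · rcases List.mem_and_mem_split hxy hxs hys with ⟨a, b, c, rfl⟩ | ⟨a, b, c, rfl⟩
    · have := congrArg (wordVal g p * · * wordVal g c)
        (key (g x) (g y) (wordVal g a) (wordVal g b)).1
      simpa [mul_assoc] using this
    · have := congrArg (wordVal g p * · * wordVal g c)
        (key (g y) (g x) (wordVal g a) (wordVal g b)).1
      simpa [mul_assoc] using this.symm

theorem move_left_of_basis (hL : MSatisfies M wL1 wL2) (hM : MSatisfies M wM1 wM2)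
    (hR : MSatisfies M wR1 wR2) (g : X → M) {w q : List X} {x : X} (p : List X)
    (h : ∀ y ∈ p, SwapContext w q x y) :
    wordVal g (w ++ (p ++ x :: q)) = wordVal g (w ++ x :: (p ++ q)) := by
  induction p generalizing w with
  | nil => simp
  | cons y p ih =>
    have h1 := ih (w := w ++ [y]) fun d hd =>
      (h d (by simp [hd])).mono (List.subset_append_left w [y]) (List.Subset.refl q)
    have h2 := swap_of_basis hL hM hR g (s := p ++ q)
      ((h y (by simp)).mono (List.Subset.refl w) (List.subset_append_right p q))
    simp only [List.append_assoc, List.cons_append, List.nil_append] at h1 h2 ⊢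
    rw [h1, h2]

theorem wordVal_eq_of_basis (hL : MSatisfies M wL1 wL2) (hM : MSatisfies M wM1 wM2)
    (hR : MSatisfies M wR1 wR2) (g : X → M) (v w u : List X) (hperm : u.Perm v)
    (h : ∀ x y, x ≠ y → ([x, y].Sublist (w ++ u) ↔ [x, y].Sublist (w ++ v))) :
    wordVal g (w ++ u) = wordVal g (w ++ v) := by
  induction v generalizing w u with
  | nil => rw [hperm.eq_nil]
  | cons x v ih =>
    have hxu : x ∈ u := hperm.mem_iff.2 (by simp)
    obtain ⟨p, q, rfl, hxp⟩ := List.eq_append_cons_of_mem hxu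
    have hpq : (p ++ q).Perm v := by
      have := List.perm_middle.symm.trans hperm
      exact List.Perm.cons_inv this
    have hmem : ∀ y, y ∈ p ∨ y ∈ q ↔ y ∈ v := fun y => by
      rw [← List.mem_append, hpq.mem_iff]
    have hctx : ∀ y ∈ p, SwapContext w q x y := by
      intro y hy
      have hxy : x ≠ y := fun e => hxp (e ▸ hy)
      have hsub : ∀ {a b : X} {l : List X}, [a, b].Sublist l → a ∈ l ∧ b ∈ l := fun hl =>
        ⟨hl.subset (by simp), hl.subset (by simp)⟩
      have h1 := h x y hxy
      have h2 := h y x hxy.symm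
      simp only [List.pair_sublist_append, List.pair_sublist_cons] at h1 h2
      unfold SwapContext
      have := hmem x
      have := hmem y
      grind
    rw [move_left_of_basis hL hM hR g p hctx]
    have := ih (w ++ [x]) (p ++ q) hpq fun s t hst => by
      have h1 := h s t hst
      simp only [List.append_assoc, List.cons_append, List.nil_append]
      rw [← h1]
      simp only [List.pair_sublist_append, List.pair_sublist_cons, List.mem_append, List.mem_cons]
      unfold SwapContext at hctx
      grind
    simpa using this

theorem wordVal_toList (ψ : FreeMonoid X →* M) (u : FreeMonoid X) :
    wordVal (fun x => ψ (of x)) u.toList = ψ u := by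
  induction u using FreeMonoid.inductionOn' with
  | one => simp
  | of_mul a w ih => simp [ih]

theorem MSatisfies.ulift {u v : FreeMonoid X} (h : MSatisfies M u v) :
    MSatisfies (ULift M) u v := fun ψ =>
  MulEquiv.ulift.injective (h ((MulEquiv.ulift : ULift M ≃* M).toMonoidHom.comp ψ))

end Completeness

/-- The set `B_hypo = {(L), (M), (R)}` of the three identities
(L) `xyzxty ≈ yxzxty`, (M) `xzxytx ≈ xzyxtx`, (R) `xzytxy ≈ xzytyx` is a (finite)
equational basis for the variety generated by `hypo`: an identity `u ≈ v` is
satisfied by `hypo` if and only if every monoid satisfying (L), (M) and (R)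
also satisfies `u ≈ v`. -/
theorem hypo_finite_basis {X : Type*} (u v : FreeMonoid X) :
    MSatisfies Hypo u v ↔
      ∀ (M : Type*) [Monoid M],
        (MSatisfies M wL1 wL2 ∧ MSatisfies M wM1 wM2 ∧ MSatisfies M wR1 wR2) →
        MSatisfies M u v := by
  refine ⟨fun h M _ hB ψ => ?_, fun h ψ => ?_⟩
  · obtain ⟨hL, hM, hR⟩ := hB
    rw [← wordVal_toList ψ u, ← wordVal_toList ψ v]
    exact wordVal_eq_of_basis hL hM hR _ v.toList [] u.toList h.perm_of_hypo
      fun x y hxy => h.pair_sublist_of_hypo hxy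
  · obtain ⟨hL, hM, hR⟩ := hypo_satisfies_basis
    have := h (ULift Hypo) ⟨hL.ulift, hM.ulift, hR.ulift⟩
      (MulEquiv.ulift.symm.toMonoidHom.comp ψ)
    exact MulEquiv.ulift.symm.injective this
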